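/- Let q belong to the Schwartz space 𝒮(ℝ;ℂ) and let λ ∈ ℂ satisfy Im(λ²) > 0. Define s₂(λ) = −λ²·I_λ({x₁<y₁}), s₄(λ) = λ⁴·I_λ({x₁<y₁<x₂<y₂}), s₆(λ) = −λ⁶·I_λ({x₁<y₁<x₂<y₂<x₃<y₃}), and b₆(λ) = s₆(λ) − s₂(λ)·s₄(λ) + s₂(λ)³/3. Then, writing ξ₃ := η₁+η₂+η₃−ξ₁−ξ₂, one has b₆(λ) = −(i/(4π²)) ∫_{ℝ⁵} ( λ⁶ / ( (2λ²+ξ₁)(2λ²+ξ₂)(2λ²+η₂)(2λ²+η₃) ) ) · ( 1/(2λ²+η₁) + 1/(2λ²+ξ₁+ξ₂−η₁) ) · q̂(ξ₁)·q̂(ξ₂)·q̂(ξ₃)·conj(q̂(η₁))·conj(q̂(η₂))·conj(q̂(η₃)) dξ₁ dξ₂ dη₁ dη₂ dη₃. -/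

import Mathlib

open MeasureTheory

/-- The elementary kernel `q(y)·conj(q(x))·exp(2iλ²(y−x))`. -/
noncomputable def ker (q : ℝ → ℂ) (lam : ℂ) (x y : ℝ) : ℂ :=
  q y * (starRingEnd ℂ) (q x) * Complex.exp (2 * Complex.I * lam ^ 2 * ((y - x : ℝ) : ℂ))

/-- Integrand on `ℝ²`, in the variables `p = (x₁, y₁)`. -/
noncomputable def f2 (q : ℝ → ℂ) (lam : ℂ) (p : ℝ × ℝ) : ℂ :=
  ker q lam p.1 p.2

/-- Integrand on `ℝ⁴`, in the variables `p = (x₁, y₁, x₂, y₂)`. -/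
noncomputable def f4 (q : ℝ → ℂ) (lam : ℂ) (p : ℝ × ℝ × ℝ × ℝ) : ℂ :=
  ker q lam p.1 p.2.1 * ker q lam p.2.2.1 p.2.2.2

/-- Integrand on `ℝ⁶`, in the variables `p = (x₁, y₁, x₂, y₂, x₃, y₃)`. -/
noncomputable def f6 (q : ℝ → ℂ) (lam : ℂ) (p : ℝ × ℝ × ℝ × ℝ × ℝ × ℝ) : ℂ :=
  ker q lam p.1 p.2.1 * ker q lam p.2.2.1 p.2.2.2.1 * ker q lam p.2.2.2.2.1 p.2.2.2.2.2

/-- The region `{x₁ < y₁}` of `ℝ²`, in the variables `p = (x₁, y₁)`. -/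
def R_XY : Set (ℝ × ℝ) := {p | p.1 < p.2}

/-- The region `{x₁ < y₁ < x₂ < y₂}` of `ℝ⁴`, in the variables `p = (x₁, y₁, x₂, y₂)`. -/
def R_XYXY : Set (ℝ × ℝ × ℝ × ℝ) :=
  {p | p.1 < p.2.1 ∧ p.2.1 < p.2.2.1 ∧ p.2.2.1 < p.2.2.2}

/-- The region `{x₁ < x₂ < y₁ < y₂}` of `ℝ⁴`, in the variables `p = (x₁, y₁, x₂, y₂)`. -/
def R_XXYY : Set (ℝ × ℝ × ℝ × ℝ) :=
  {p | p.1 < p.2.2.1 ∧ p.2.2.1 < p.2.1 ∧ p.2.1 < p.2.2.2}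

/-- The region `{x₁ < y₁ < x₂ < y₂ < x₃ < y₃}` of `ℝ⁶`,
in the variables `p = (x₁, y₁, x₂, y₂, x₃, y₃)`. -/
def R_XYXYXY : Set (ℝ × ℝ × ℝ × ℝ × ℝ × ℝ) :=
  {p | p.1 < p.2.1 ∧ p.2.1 < p.2.2.1 ∧ p.2.2.1 < p.2.2.2.1 ∧
       p.2.2.2.1 < p.2.2.2.2.1 ∧ p.2.2.2.2.1 < p.2.2.2.2.2}

/-- The region `{x₁ < x₂ < y₁ < y₂ < x₃ < y₃}` of `ℝ⁶`,
in the variables `p = (x₁, y₁, x₂, y₂, x₃, y₃)`. -/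
def R_XXYYXY : Set (ℝ × ℝ × ℝ × ℝ × ℝ × ℝ) :=
  {p | p.1 < p.2.2.1 ∧ p.2.2.1 < p.2.1 ∧ p.2.1 < p.2.2.2.1 ∧
       p.2.2.2.1 < p.2.2.2.2.1 ∧ p.2.2.2.2.1 < p.2.2.2.2.2}

/-- The region `{x₁ < x₂ < y₁ < x₃ < y₂ < y₃}` of `ℝ⁶`,
in the variables `p = (x₁, y₁, x₂, y₂, x₃, y₃)`. -/
def R_XXYXYY : Set (ℝ × ℝ × ℝ × ℝ × ℝ × ℝ) :=
  {p | p.1 < p.2.2.1 ∧ p.2.2.1 < p.2.1 ∧ p.2.1 < p.2.2.2.2.1 ∧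
       p.2.2.2.2.1 < p.2.2.2.1 ∧ p.2.2.2.1 < p.2.2.2.2.2}

/-- The region `{x₁ < y₁ < x₂ < x₃ < y₂ < y₃}` of `ℝ⁶`,
in the variables `p = (x₁, y₁, x₂, y₂, x₃, y₃)`. -/
def R_XYXXYY : Set (ℝ × ℝ × ℝ × ℝ × ℝ × ℝ) :=
  {p | p.1 < p.2.1 ∧ p.2.1 < p.2.2.1 ∧ p.2.2.1 < p.2.2.2.2.1 ∧
       p.2.2.2.2.1 < p.2.2.2.1 ∧ p.2.2.2.1 < p.2.2.2.2.2}

/-- The region `{x₁ < x₂ < x₃ < y₁ < y₂ < y₃}` of `ℝ⁶`,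
in the variables `p = (x₁, y₁, x₂, y₂, x₃, y₃)`. -/
def R_XXXYYY : Set (ℝ × ℝ × ℝ × ℝ × ℝ × ℝ) :=
  {p | p.1 < p.2.2.1 ∧ p.2.2.1 < p.2.2.2.2.1 ∧ p.2.2.2.2.1 < p.2.1 ∧
       p.2.1 < p.2.2.2.1 ∧ p.2.2.2.1 < p.2.2.2.2.2}

/-- The unitary Fourier transform `q̂(ξ) = (2π)^{−1/2} ∫ q(x) e^{−ixξ} dx`. -/
noncomputable def ft (q : ℝ → ℂ) (ξ : ℝ) : ℂ :=
  ((Real.sqrt (2 * Real.pi) : ℝ) : ℂ)⁻¹ * ∫ x : ℝ, q x * Complex.exp (-Complex.I * x * ξ)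


open Set Topology
open Filter hiding ker

/-- The causal resolvent `f ↦ ∫_{t>x} e^{im(t-x)} f(t) dt`. -/
noncomputable def causalResolvent (m : ℂ) (f : ℝ → ℂ) (x : ℝ) : ℂ :=
  ∫ t in Ioi x, Complex.exp (Complex.I * m * ((t - x : ℝ) : ℂ)) * f t

lemma norm_exp_I_mul_le_one {m : ℂ} (hm : 0 < m.im) {s : ℝ} (hs : 0 ≤ s) :
    ‖Complex.exp (Complex.I * m * (s : ℂ))‖ ≤ 1 := by
  rw [Complex.norm_exp, Real.exp_le_one_iff]
  simp
  positivity

lemma norm_causalResolvent_le {m : ℂ} (hm : 0 < m.im) {f : ℝ → ℂ} (hf : Integrable f) (x : ℝ) :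
    ‖causalResolvent m f x‖ ≤ ∫ t in Ioi x, ‖f t‖ := by
  refine norm_integral_le_of_norm_le hf.norm.integrableOn ?_
  refine (ae_restrict_iff' measurableSet_Ioi).2 (Eventually.of_forall fun t ht => ?_)
  rw [norm_mul]
  exact mul_le_of_le_one_left (norm_nonneg _)
    (norm_exp_I_mul_le_one hm (sub_nonneg.2 (le_of_lt ht)))

lemma norm_causalResolvent_le_integral {m : ℂ} (hm : 0 < m.im) {f : ℝ → ℂ} (hf : Integrable f)
    (x : ℝ) : ‖causalResolvent m f x‖ ≤ ∫ t, ‖f t‖ :=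
  (norm_causalResolvent_le hm hf x).trans
    (setIntegral_le_integral hf.norm (Eventually.of_forall fun _ => norm_nonneg _))

lemma tendsto_tail_integral_atBot {E : Type*} [NormedAddCommGroup E] [NormedSpace ℝ E]
    {f : ℝ → E} (hf : Integrable f) :
    Tendsto (fun x => ∫ t in Ioi x, f t) atBot (𝓝 (∫ t, f t)) :=
  (aecover_Ioi tendsto_id).integral_tendsto_of_countably_generated hf

lemma tendsto_tail_integral_atTop {E : Type*} [NormedAddCommGroup E] [NormedSpace ℝ E]
    {f : ℝ → E} (hf : Integrable f) :
    Tendsto (fun x => ∫ t in Ioi x, f t) atTop (𝓝 0) := by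
  have h := ((aecover_Iic (μ := volume) (l := atTop) (b := fun x : ℝ => x)
    tendsto_id).integral_tendsto_of_countably_generated hf).const_sub (∫ t, f t)
  rw [sub_self] at h
  refine h.congr fun x => ?_
  rw [← compl_Iic, ← integral_add_compl (measurableSet_Iic (a := x)) hf, add_sub_cancel_left]

lemma tendsto_causalResolvent_atTop {m : ℂ} (hm : 0 < m.im) {f : ℝ → ℂ} (hf : Integrable f) :
    Tendsto (causalResolvent m f) atTop (𝓝 0) :=
  squeeze_zero_norm (norm_causalResolvent_le hm hf) (tendsto_tail_integral_atTop hf.norm)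

lemma hasDerivAt_tail_integral {f : ℝ → ℂ} (hc : Continuous f)
    (hf : ∀ x, IntegrableOn f (Ioi x)) (x : ℝ) :
    HasDerivAt (fun x => ∫ t in Ioi x, f t) (-f x) x := by
  have h : (fun x => ∫ t in Ioi x, f t)
      = fun x => (∫ t in Ioi (0 : ℝ), f t) - ∫ t in (0 : ℝ)..x, f t := by
    ext y
    rw [← intervalIntegral.integral_interval_add_Ioi (hf 0) (hf y), add_sub_cancel_left]
  rw [h]
  exact (intervalIntegral.integral_hasDerivAt_right (hc.intervalIntegrable _ _)
    (hc.stronglyMeasurableAtFilter _ _) hc.continuousAt).const_sub _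

lemma hasDerivAt_causalResolvent {m : ℂ} (hm : 0 < m.im) {f : ℝ → ℂ} (hc : Continuous f)
    (hf : Integrable f) (x : ℝ) :
    HasDerivAt (causalResolvent m f) (-(Complex.I * m) * causalResolvent m f x - f x) x := by
  have key : ∀ y, causalResolvent m f y = Complex.exp (-(Complex.I * m) * (y : ℂ)) *
      ∫ t in Ioi y, Complex.exp (Complex.I * m * (t : ℂ)) * f t := by
    intro y
    rw [causalResolvent, ← integral_const_mul]
    congr 1 with t
    rw [← mul_assoc, ← Complex.exp_add]
    congr 2
    push_cast
    ring
  have hint : ∀ y, IntegrableOn (fun t : ℝ => Complex.exp (Complex.I * m * (t : ℂ)) * f t)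
      (Ioi y) := by
    intro y
    refine Integrable.bdd_mul (c := ‖Complex.exp (Complex.I * m * (y : ℂ))‖) hf.integrableOn
      (by fun_prop) ?_
    refine (ae_restrict_iff' measurableSet_Ioi).2 (Eventually.of_forall fun t ht => ?_)
    rw [Complex.norm_exp, Complex.norm_exp, Real.exp_le_exp]
    simp only [Complex.mul_re, Complex.I_re, zero_mul, Complex.I_im, one_mul, zero_sub,
      Complex.ofReal_re, Complex.mul_im, zero_add, Complex.ofReal_im, mul_zero, sub_zero]
    have : y < t := ht
    nlinarith
  have h1 : HasDerivAt (fun y : ℝ => Complex.exp (-(Complex.I * m) * (y : ℂ)))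
      (Complex.exp (-(Complex.I * m) * (x : ℂ)) * (-(Complex.I * m) * 1)) x :=
    ((Complex.ofRealCLM.hasDerivAt (x := x)).const_mul _).cexp
  have h2 := hasDerivAt_tail_integral
    (f := fun t : ℝ => Complex.exp (Complex.I * m * (t : ℂ)) * f t) (by fun_prop) hint x
  refine ((h1.mul h2).congr_of_eventuallyEq (Eventually.of_forall key)).congr_deriv ?_
  rw [key x]
  have : Complex.exp (-(Complex.I * m) * (x : ℂ)) * Complex.exp (Complex.I * m * (x : ℂ)) = 1 := by
    rw [← Complex.exp_add]; simp
  linear_combination -f x * this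

lemma continuous_causalResolvent {m : ℂ} (hm : 0 < m.im) {f : ℝ → ℂ} (hc : Continuous f)
    (hf : Integrable f) : Continuous (causalResolvent m f) :=
  continuous_iff_continuousAt.2 fun x => (hasDerivAt_causalResolvent hm hc hf x).continuousAt

/-- A solution of `f' = -imf - g` vanishing at `+∞` is the causal resolvent of `g`. -/
lemma eq_causalResolvent_of_hasDerivAt {m : ℂ} (hm : 0 < m.im) {f g : ℝ → ℂ} (hc : Continuous g)
    (hg : Integrable g) (hf : ∀ x, HasDerivAt f (-(Complex.I * m) * f x - g x) x)
    (hlim : Tendsto f atTop (𝓝 0)) : f = causalResolvent m g := by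
  have hd : ∀ x, HasDerivAt (fun y : ℝ => Complex.exp (Complex.I * m * (y : ℂ)) *
      (f y - causalResolvent m g y)) 0 x := by
    intro x
    have h1 : HasDerivAt (fun y : ℝ => Complex.exp (Complex.I * m * (y : ℂ)))
        (Complex.exp (Complex.I * m * (x : ℂ)) * (Complex.I * m * 1)) x :=
      ((Complex.ofRealCLM.hasDerivAt (x := x)).const_mul _).cexp
    refine (h1.mul ((hf x).sub (hasDerivAt_causalResolvent hm hc hg x))).congr_deriv ?_
    simp only [Pi.sub_apply]
    ring
  have hconst := is_const_of_deriv_eq_zero (fun x => (hd x).differentiableAt)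
    (fun x => (hd x).deriv)
  have hz : Tendsto (fun y : ℝ => Complex.exp (Complex.I * m * (y : ℂ)) *
      (f y - causalResolvent m g y)) atTop (𝓝 0) := by
    refine squeeze_zero_norm' (a := fun y => ‖f y - causalResolvent m g y‖) ?_ ?_
    · filter_upwards [eventually_ge_atTop (0 : ℝ)] with y hy
      rw [norm_mul]
      exact mul_le_of_le_one_left (norm_nonneg _) (norm_exp_I_mul_le_one hm hy)
    · simpa using (hlim.sub (tendsto_causalResolvent_atTop hm hg)).norm
  ext x
  have hx : Complex.exp (Complex.I * m * (x : ℂ)) * (f x - causalResolvent m g x) = 0 :=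
    tendsto_nhds_unique (tendsto_const_nhds.congr fun y => hconst x y) hz
  exact sub_eq_zero.1 ((mul_eq_zero.1 hx).resolve_left (Complex.exp_ne_zero _))

/-- The iterated tail functional `t ↦ ∫_{t<x<y} conj(q(x)) q(y) e^{im(y-x)} E(y) dx dy`. -/
noncomputable def iteratedTail (m : ℂ) (q E : ℝ → ℂ) (t : ℝ) : ℂ :=
  ∫ x in Ioi t, (starRingEnd ℂ) (q x) * causalResolvent m (fun y => q y * E y) x

/-- The anticausal resolvent of `conj q`, namely `x ↦ ∫_{s<x} e^{im(x-s)} conj(q(s)) ds`. -/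
noncomputable def anticausalConj (m : ℂ) (q : ℝ → ℂ) (x : ℝ) : ℂ :=
  causalResolvent m (fun t => (starRingEnd ℂ) (q (-t))) (-x)

lemma integrable_conj {q : ℝ → ℂ} (hi : Integrable q) :
    Integrable (fun x => (starRingEnd ℂ) (q x)) :=
  Complex.conjCLE.toContinuousLinearMap.integrable_comp hi

section Continuity

variable {m : ℂ} {q E : ℝ → ℂ}

lemma integrable_mul_of_bounded (hi : Integrable q) (hE : Continuous E)
    (hb : ∃ C, ∀ x, ‖E x‖ ≤ C) : Integrable (fun x => q x * E x) := by
  obtain ⟨C, hC⟩ := hb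
  exact hi.mul_bdd hE.aestronglyMeasurable (Eventually.of_forall hC)

lemma exists_bound_causalResolvent (hm : 0 < m.im) (hi : Integrable q) :
    ∃ C, ∀ x, ‖causalResolvent m q x‖ ≤ C :=
  ⟨_, norm_causalResolvent_le_integral hm hi⟩

lemma integrable_conj_mul_causalResolvent (hm : 0 < m.im) (hc : Continuous q)
    (hi : Integrable q) (hE : Continuous E) (hb : ∃ C, ∀ x, ‖E x‖ ≤ C) :
    Integrable (fun x => (starRingEnd ℂ) (q x) * causalResolvent m (fun y => q y * E y) x) := by
  have h := integrable_mul_of_bounded hi hE hb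
  exact integrable_mul_of_bounded (integrable_conj hi)
    (continuous_causalResolvent hm (hc.mul hE) h) (exists_bound_causalResolvent hm h)

lemma hasDerivAt_iteratedTail (hm : 0 < m.im) (hc : Continuous q)
    (hi : Integrable q) (hE : Continuous E) (hb : ∃ C, ∀ x, ‖E x‖ ≤ C) (x : ℝ) :
    HasDerivAt (iteratedTail m q E)
      (-((starRingEnd ℂ) (q x) * causalResolvent m (fun y => q y * E y) x)) x := by
  have h := continuous_causalResolvent hm (hc.mul hE) (integrable_mul_of_bounded hi hE hb)
  exact hasDerivAt_tail_integral ((Complex.continuous_conj.comp hc).mul h)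
    (fun x => (integrable_conj_mul_causalResolvent hm hc hi hE hb).integrableOn) x

lemma continuous_iteratedTail (hm : 0 < m.im) (hc : Continuous q)
    (hi : Integrable q) (hE : Continuous E) (hb : ∃ C, ∀ x, ‖E x‖ ≤ C) :
    Continuous (iteratedTail m q E) :=
  continuous_iff_continuousAt.2 fun x =>
    (hasDerivAt_iteratedTail hm hc hi hE hb x).continuousAt

lemma exists_bound_iteratedTail (hm : 0 < m.im) (hc : Continuous q)
    (hi : Integrable q) (hE : Continuous E) (hb : ∃ C, ∀ x, ‖E x‖ ≤ C) :
    ∃ C, ∀ x, ‖iteratedTail m q E x‖ ≤ C := by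
  have h := integrable_conj_mul_causalResolvent hm hc hi hE hb
  exact ⟨_, fun x => (norm_integral_le_integral_norm _).trans
    (setIntegral_le_integral h.norm (Eventually.of_forall fun _ => norm_nonneg _))⟩

lemma integrable_conj_comp_neg (hi : Integrable q) :
    Integrable (fun t => (starRingEnd ℂ) (q (-t))) :=
  integrable_conj hi.comp_neg

lemma hasDerivAt_anticausalConj (hm : 0 < m.im) (hc : Continuous q) (hi : Integrable q) (x : ℝ) :
    HasDerivAt (anticausalConj m q)
      (Complex.I * m * anticausalConj m q x + (starRingEnd ℂ) (q x)) x := by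
  have h := hasDerivAt_causalResolvent hm
    (Complex.continuous_conj.comp (hc.comp continuous_neg)) (integrable_conj_comp_neg hi) (-x)
  refine (h.scomp x (hasDerivAt_neg x)).congr_deriv ?_
  simp only [anticausalConj, Function.comp_apply, neg_neg, neg_smul, one_smul]
  ring_nf
  rfl

lemma continuous_anticausalConj (hm : 0 < m.im) (hc : Continuous q) (hi : Integrable q) :
    Continuous (anticausalConj m q) :=
  continuous_iff_continuousAt.2 fun x => (hasDerivAt_anticausalConj hm hc hi x).continuousAt

lemma exists_bound_anticausalConj (hm : 0 < m.im) (hi : Integrable q) :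
    ∃ C, ∀ x, ‖anticausalConj m q x‖ ≤ C :=
  ⟨_, fun _ => norm_causalResolvent_le_integral hm (integrable_conj_comp_neg hi) _⟩

lemma tendsto_anticausalConj_mul_causalResolvent_atTop (hm : 0 < m.im) (hi : Integrable q)
    {f : ℝ → ℂ} (hf : Integrable f) :
    Tendsto (fun x => anticausalConj m q x * causalResolvent m f x) atTop (𝓝 0) := by
  obtain ⟨C, hC⟩ := exists_bound_anticausalConj hm hi
  simp_rw [mul_comm (anticausalConj m q _)]
  exact (tendsto_causalResolvent_atTop hm hf).zero_mul_isBoundedUnder_le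
    (isBoundedUnder_of ⟨C, hC⟩)

lemma tendsto_anticausalConj_mul_causalResolvent_atBot (hm : 0 < m.im) (hi : Integrable q)
    {f : ℝ → ℂ} (hf : Integrable f) :
    Tendsto (fun x => anticausalConj m q x * causalResolvent m f x) atBot (𝓝 0) := by
  obtain ⟨C, hC⟩ := exists_bound_causalResolvent hm hf
  have h : Tendsto (anticausalConj m q) atBot (𝓝 0) :=
    (tendsto_causalResolvent_atTop hm (integrable_conj_comp_neg hi)).comp tendsto_neg_atBot_atTop
  exact h.zero_mul_isBoundedUnder_le (isBoundedUnder_of ⟨C, hC⟩)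

end Continuity

/-- The third cumulant of the iterated integrals, in terms of causal and anticausal resolvents. -/
lemma cumulant_eq_integral_resolvents {m : ℂ} (hm : 0 < m.im) {q : ℝ → ℂ} (hc : Continuous q)
    (hi : Integrable q) {a b E₁ E₂ a₂ a₃ : ℝ → ℂ} (ha : a = causalResolvent m q)
    (hbdef : b = anticausalConj m q)
    (hE₁ : E₁ = iteratedTail m q (fun _ => 1)) (hE₂ : E₂ = iteratedTail m q E₁)
    (ha₂ : a₂ = causalResolvent m (fun y => q y * E₁ y))
    (ha₃ : a₃ = causalResolvent m (fun y => q y * E₂ y)) :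
    -(∫ x, (starRingEnd ℂ) (q x) * a₃ x)
      + (∫ x, (starRingEnd ℂ) (q x) * a x) * (∫ x, (starRingEnd ℂ) (q x) * a₂ x)
      - (∫ x, (starRingEnd ℂ) (q x) * a x) ^ 3 / 3
      = -∫ x, q x * (a x ^ 2 * b x ^ 3
          + b x ^ 2 * causalResolvent m (fun t => a t ^ 2 * (starRingEnd ℂ) (q t)) x) := by
  have c1 : Continuous (fun _ : ℝ => (1 : ℂ)) := continuous_const
  have b1 : ∃ C, ∀ x : ℝ, ‖(fun _ : ℝ => (1 : ℂ)) x‖ ≤ C := ⟨1, fun _ => by simp⟩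
  have cE₁ : Continuous E₁ := hE₁ ▸ continuous_iteratedTail hm hc hi c1 b1
  have bE₁ : ∃ C, ∀ x, ‖E₁ x‖ ≤ C := hE₁ ▸ exists_bound_iteratedTail hm hc hi c1 b1
  have cE₂ : Continuous E₂ := hE₂ ▸ continuous_iteratedTail hm hc hi cE₁ bE₁
  have bE₂ : ∃ C, ∀ x, ‖E₂ x‖ ≤ C := hE₂ ▸ exists_bound_iteratedTail hm hc hi cE₁ bE₁
  have ha' : a = causalResolvent m (fun y => q y * 1) := by simpa using ha
  have ca : Continuous a := ha ▸ continuous_causalResolvent hm hc hi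
  have ba : ∃ C, ∀ x, ‖a x‖ ≤ C := ha ▸ exists_bound_causalResolvent hm hi
  have cb : Continuous b := hbdef ▸ continuous_anticausalConj hm hc hi
  have bb : ∃ C, ∀ x, ‖b x‖ ≤ C := hbdef ▸ exists_bound_anticausalConj hm hi
  have cq : Continuous (fun x => (starRingEnd ℂ) (q x)) := Complex.continuous_conj.comp hc
  have i₁ := integrable_mul_of_bounded hi cE₁ bE₁
  have i₂ := integrable_mul_of_bounded hi cE₂ bE₂
  have da : ∀ x, HasDerivAt a (-(Complex.I * m) * a x - q x) x := fun x =>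
    ha ▸ hasDerivAt_causalResolvent hm hc hi x
  have da₂ : ∀ x, HasDerivAt a₂ (-(Complex.I * m) * a₂ x - q x * E₁ x) x := fun x =>
    ha₂ ▸ hasDerivAt_causalResolvent hm (hc.mul cE₁) i₁ x
  have da₃ : ∀ x, HasDerivAt a₃ (-(Complex.I * m) * a₃ x - q x * E₂ x) x := fun x =>
    ha₃ ▸ hasDerivAt_causalResolvent hm (hc.mul cE₂) i₂ x
  have db : ∀ x, HasDerivAt b (Complex.I * m * b x + (starRingEnd ℂ) (q x)) x := fun x =>
    hbdef ▸ hasDerivAt_anticausalConj hm hc hi x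
  have dE₁ : ∀ x, HasDerivAt E₁ (-((starRingEnd ℂ) (q x) * a x)) x := fun x => by
    rw [hE₁, ha']; exact hasDerivAt_iteratedTail hm hc hi c1 b1 x
  have dE₂ : ∀ x, HasDerivAt E₂ (-((starRingEnd ℂ) (q x) * a₂ x)) x := fun x => by
    rw [hE₂, ha₂]; exact hasDerivAt_iteratedTail hm hc hi cE₁ bE₁ x
  obtain ⟨E₃, hE₃⟩ : ∃ E₃, E₃ = iteratedTail m q E₂ := ⟨_, rfl⟩
  have dE₃ : ∀ x, HasDerivAt E₃ (-((starRingEnd ℂ) (q x) * a₃ x)) x := fun x => by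
    rw [hE₃, ha₃]; exact hasDerivAt_iteratedTail hm hc hi cE₂ bE₂ x
  have j₁ : Integrable (fun x => (starRingEnd ℂ) (q x) * a x) := by
    rw [ha']; exact integrable_conj_mul_causalResolvent hm hc hi c1 b1
  have j₂ : Integrable (fun x => (starRingEnd ℂ) (q x) * a₂ x) := by
    rw [ha₂]; exact integrable_conj_mul_causalResolvent hm hc hi cE₁ bE₁
  have j₃ : Integrable (fun x => (starRingEnd ℂ) (q x) * a₃ x) := by
    rw [ha₃]; exact integrable_conj_mul_causalResolvent hm hc hi cE₂ bE₂
  have tE₁ : Tendsto E₁ atBot (𝓝 (∫ x, (starRingEnd ℂ) (q x) * a x)) := by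
    rw [hE₁, ha']; rw [ha'] at j₁; exact tendsto_tail_integral_atBot j₁
  have tE₂ : Tendsto E₂ atBot (𝓝 (∫ x, (starRingEnd ℂ) (q x) * a₂ x)) := by
    rw [hE₂, ha₂]; rw [ha₂] at j₂; exact tendsto_tail_integral_atBot j₂
  have tE₃ : Tendsto E₃ atBot (𝓝 (∫ x, (starRingEnd ℂ) (q x) * a₃ x)) := by
    rw [hE₃, ha₃]; rw [ha₃] at j₃; exact tendsto_tail_integral_atBot j₃
  have zE₁ : Tendsto E₁ atTop (𝓝 0) := by
    rw [hE₁]; rw [ha'] at j₁; exact tendsto_tail_integral_atTop j₁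
  have zE₂ : Tendsto E₂ atTop (𝓝 0) := by
    rw [hE₂]; rw [ha₂] at j₂; exact tendsto_tail_integral_atTop j₂
  have zE₃ : Tendsto E₃ atTop (𝓝 0) := by
    rw [hE₃]; rw [ha₃] at j₃; exact tendsto_tail_integral_atTop j₃
  have iaq : Integrable (fun t => a t ^ 2 * (starRingEnd ℂ) (q t)) := by
    obtain ⟨C, hC⟩ := ba
    refine (integrable_mul_of_bounded (integrable_conj hi) (ca.pow 2)
      ⟨C ^ 2, fun x => ?_⟩).congr (Eventually.of_forall fun x => mul_comm _ _)
    rw [Pi.pow_apply, norm_pow]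
    gcongr
    exact hC x
  have caq : Continuous (fun t => a t ^ 2 * (starRingEnd ℂ) (q t)) := (ca.pow 2).mul cq
  have hh : (fun x => E₁ x * a x - a₂ x)
      = causalResolvent m (fun t => a t ^ 2 * (starRingEnd ℂ) (q t)) := by
    refine eq_causalResolvent_of_hasDerivAt hm caq iaq (fun x => ?_) ?_
    · refine (((dE₁ x).mul (da x)).sub (da₂ x)).congr_deriv ?_
      ring
    · have h1 := tendsto_causalResolvent_atTop hm hi
      have h2 := tendsto_causalResolvent_atTop hm i₁
      rw [← ha] at h1
      rw [← ha₂] at h2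
      simpa using (zE₁.mul h1).sub h2
  have ch := continuous_causalResolvent hm caq iaq
  have bh := exists_bound_causalResolvent hm iaq
  have hint : Integrable (fun x => q x * (a x ^ 2 * b x ^ 3
      + b x ^ 2 * causalResolvent m (fun t => a t ^ 2 * (starRingEnd ℂ) (q t)) x)) := by
    obtain ⟨A, hA⟩ := ba
    obtain ⟨B, hB⟩ := bb
    obtain ⟨D, hD⟩ := bh
    refine integrable_mul_of_bounded hi (by fun_prop) ⟨A ^ 2 * B ^ 3 + B ^ 2 * D, fun x => ?_⟩
    refine (norm_add_le _ _).trans ?_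
    simp only [norm_mul, norm_pow]
    have := hA x
    have := hB x
    have := hD x
    have : 0 ≤ A := (norm_nonneg _).trans (hA x)
    have : 0 ≤ B := (norm_nonneg _).trans (hB x)
    gcongr
  have hderiv : ∀ x, HasDerivAt (fun x => -E₃ x + E₁ x * E₂ x - E₁ x ^ 3 / 3
      - (b x * a₃ x - (b x * a x) * E₂ x - E₁ x * (b x * a₂ x) + E₁ x ^ 2 * (b x * a x))
      - (b x * a x) * (E₁ x * (b x * a x) - b x * a₂ x) - (b x * a x) ^ 3 / 3)
      (q x * (a x ^ 2 * b x ^ 3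
        + b x ^ 2 * causalResolvent m (fun t => a t ^ 2 * (starRingEnd ℂ) (q t)) x)) x := by
    intro x
    rw [← hh]
    have u := (db x).mul (da x)
    have v := (db x).mul (da₂ x)
    have w := (db x).mul (da₃ x)
    refine (((((dE₃ x).neg.add ((dE₁ x).mul (dE₂ x))).sub (((dE₁ x).pow 3).div_const 3)).sub
      (((w.sub (u.mul (dE₂ x))).sub ((dE₁ x).mul v)).add (((dE₁ x).pow 2).mul u))).sub
      (u.mul (((dE₁ x).mul u).sub v))).sub ((u.pow 3).div_const 3) |>.congr_deriv ?_
    simp only [Pi.mul_apply, Pi.pow_apply, Pi.sub_apply]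
    push_cast
    ring
  have ub := tendsto_anticausalConj_mul_causalResolvent_atBot hm hi hi
  have vb := tendsto_anticausalConj_mul_causalResolvent_atBot hm hi i₁
  have wb := tendsto_anticausalConj_mul_causalResolvent_atBot hm hi i₂
  have ut := tendsto_anticausalConj_mul_causalResolvent_atTop hm hi hi
  have vt := tendsto_anticausalConj_mul_causalResolvent_atTop hm hi i₁
  have wt := tendsto_anticausalConj_mul_causalResolvent_atTop hm hi i₂
  simp only [← ha, ← ha₂, ← ha₃, ← hbdef] at ub vb wb ut vt wt
  have hbot := (((tE₃.neg.add (tE₁.mul tE₂)).sub ((tE₁.pow 3).div_const 3)).sub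
      (((wb.sub (ub.mul tE₂)).sub (tE₁.mul vb)).add ((tE₁.pow 2).mul ub))).sub
      (ub.mul ((tE₁.mul ub).sub vb)) |>.sub ((ub.pow 3).div_const 3)
  have htop := (((zE₃.neg.add (zE₁.mul zE₂)).sub ((zE₁.pow 3).div_const 3)).sub
      (((wt.sub (ut.mul zE₂)).sub (zE₁.mul vt)).add ((zE₁.pow 2).mul ut))).sub
      (ut.mul ((zE₁.mul ut).sub vt)) |>.sub ((ut.pow 3).div_const 3)
  rw [integral_of_hasDerivAt_of_tendsto hderiv hint hbot htop]
  ring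

section Regions

variable {q : ℝ → ℂ} {lam : ℂ}

lemma ker_eq (x y : ℝ) : ker q lam x y = (starRingEnd ℂ) (q x) *
    (Complex.exp (Complex.I * (2 * lam ^ 2) * ((y - x : ℝ) : ℂ)) * q y) := by
  rw [ker, show 2 * Complex.I * lam ^ 2 = Complex.I * (2 * lam ^ 2) by ring]
  ring

lemma norm_ker_le (hm : 0 < (2 * lam ^ 2).im) {x y : ℝ} (h : x < y) :
    ‖ker q lam x y‖ ≤ ‖q x‖ * ‖q y‖ := by
  rw [ker_eq, norm_mul, norm_mul, RCLike.norm_conj]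
  gcongr
  exact mul_le_of_le_one_left (norm_nonneg _) (norm_exp_I_mul_le_one hm (sub_nonneg.2 h.le))

lemma continuous_ker (hc : Continuous q) :
    Continuous (fun p : ℝ × ℝ => ker q lam p.1 p.2) := by
  have h := Complex.continuous_conj.comp hc
  simp only [ker_eq]
  exact (h.comp continuous_fst).mul ((by fun_prop : Continuous fun p : ℝ × ℝ =>
    Complex.exp (Complex.I * (2 * lam ^ 2) * ((p.2 - p.1 : ℝ) : ℂ)) * q p.2))

lemma integral_indicator_Ioi_ker_mul (E : ℝ → ℂ) (x : ℝ) :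
    (∫ y, (Ioi x).indicator (fun y => ker q lam x y * E y) y)
      = (starRingEnd ℂ) (q x) * causalResolvent (2 * lam ^ 2) (fun y => q y * E y) x := by
  rw [integral_indicator measurableSet_Ioi, causalResolvent, ← integral_const_mul]
  simp only [ker_eq, mul_assoc]

lemma measurableSet_R_XY : MeasurableSet R_XY :=
  measurableSet_lt measurable_fst measurable_snd

lemma integrable_indicator_f2 (hm : 0 < (2 * lam ^ 2).im) (hc : Continuous q)
    (hi : Integrable q) : Integrable (R_XY.indicator (f2 q lam)) := by
  refine (hi.norm.mul_prod hi.norm).mono'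
    ((continuous_ker hc).measurable.indicator measurableSet_R_XY).aestronglyMeasurable
    (Eventually.of_forall fun p => ?_)
  by_cases hp : p ∈ R_XY
  · rw [indicator_of_mem hp]
    exact norm_ker_le hm hp
  · rw [indicator_of_notMem hp, norm_zero]
    positivity

lemma setIntegral_prod_univ_f2 (hm : 0 < (2 * lam ^ 2).im) (hc : Continuous q)
    (hi : Integrable q) (B : Set ℝ) :
    (∫ p in B ×ˢ (univ : Set ℝ), R_XY.indicator (f2 q lam) p)
      = ∫ x in B, (starRingEnd ℂ) (q x) *
          causalResolvent (2 * lam ^ 2) (fun y => q y * 1) x := by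
  rw [Measure.volume_eq_prod,
    setIntegral_prod _ (integrable_indicator_f2 hm hc hi).integrableOn]
  simp only [Measure.restrict_univ]
  congr 1 with x
  rw [← integral_indicator_Ioi_ker_mul]
  congr 1 with y
  by_cases hxy : x < y <;> simp [indicator, R_XY, f2, hxy]

variable {Y : Type*} [MeasureSpace Y]

/-- Prepending the pair `x < y` to a configuration whose first variable exceeds `y`. -/
noncomputable def prependPair (q : ℝ → ℂ) (lam : ℂ) (g : ℝ × Y → ℂ) :
    ℝ × ℝ × ℝ × Y → ℂ :=
  {p : ℝ × ℝ × ℝ × Y | p.1 < p.2.1 ∧ p.2.1 < p.2.2.1}.indicator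
    (fun p => ker q lam p.1 p.2.1 * g p.2.2)

lemma integrable_prependPair (hm : 0 < (2 * lam ^ 2).im) (hc : Continuous q)
    (hi : Integrable q) {g : ℝ × Y → ℂ} (hg : Integrable g) :
    Integrable (prependPair q lam g) := by
  have hS : MeasurableSet {p : ℝ × ℝ × ℝ × Y | p.1 < p.2.1 ∧ p.2.1 < p.2.2.1} := by
    rw [ofPred_and]
    refine (measurableSet_lt ?_ ?_).inter (measurableSet_lt ?_ ?_) <;> fun_prop
  have hk : AEStronglyMeasurable (fun p : ℝ × ℝ × ℝ × Y => ker q lam p.1 p.2.1) volume :=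
    ((continuous_ker (lam := lam) hc).measurable.comp
      (by fun_prop : Measurable fun p : ℝ × ℝ × ℝ × Y => (p.1, p.2.1))).aestronglyMeasurable
  have hg' : AEStronglyMeasurable (fun p : ℝ × ℝ × ℝ × Y => g p.2.2) volume :=
    hg.aestronglyMeasurable.comp_snd.comp_snd
  refine (hi.norm.mul_prod (hi.norm.mul_prod hg.norm)).mono' ((hk.mul hg').indicator hS)
    (Eventually.of_forall fun p => ?_)
  by_cases hp : p.1 < p.2.1 ∧ p.2.1 < p.2.2.1
  · rw [prependPair, indicator_of_mem (by exact hp), norm_mul, ← mul_assoc]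
    gcongr
    exact norm_ker_le hm hp.1
  · rw [prependPair, indicator_of_notMem (by exact hp), norm_zero]
    positivity

lemma setIntegral_prod_univ_prependPair [SFinite (volume : Measure Y)] (hm : 0 < (2 * lam ^ 2).im) (hc : Continuous q)
    (hi : Integrable q) {g : ℝ × Y → ℂ} (hg : Integrable g) (B : Set ℝ) :
    (∫ p in B ×ˢ (univ : Set (ℝ × ℝ × Y)), prependPair q lam g p)
      = ∫ x in B, (starRingEnd ℂ) (q x) * causalResolvent (2 * lam ^ 2)
          (fun y => q y * ∫ p in Ioi y ×ˢ (univ : Set Y), g p) x := by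
  have h := integrable_prependPair hm hc hi hg
  rw [Measure.volume_eq_prod, setIntegral_prod _ h.integrableOn]
  simp only [Measure.restrict_univ]
  refine integral_congr_ae (ae_restrict_of_ae ?_)
  filter_upwards [Integrable.prod_right_ae h] with x hx
  rw [Measure.volume_eq_prod, integral_prod _ hx, ← integral_indicator_Ioi_ker_mul]
  congr 1 with y
  by_cases hxy : x < y
  · rw [indicator_of_mem (by exact hxy),
      ← integral_indicator (measurableSet_Ioi.prod MeasurableSet.univ), ← integral_const_mul]
    congr 1 with p
    simp [prependPair, indicator, hxy]
  · rw [indicator_of_notMem (by exact hxy)]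
    simp [prependPair, indicator, hxy]

lemma indicator_f4_eq_prependPair :
    R_XYXY.indicator (f4 q lam) = prependPair q lam (R_XY.indicator (f2 q lam)) := by
  ext p
  by_cases h1 : p.1 < p.2.1 <;> by_cases h2 : p.2.1 < p.2.2.1 <;>
    by_cases h3 : p.2.2.1 < p.2.2.2 <;>
    simp [prependPair, indicator, R_XYXY, R_XY, f4, f2, h1, h2, h3]

lemma indicator_f6_eq_prependPair :
    R_XYXYXY.indicator (f6 q lam) = prependPair q lam (R_XYXY.indicator (f4 q lam)) := by
  ext p
  by_cases h : p.2.2 ∈ R_XYXY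
  · have h' := h
    obtain ⟨h3, h4, h5⟩ := h'
    by_cases h1 : p.1 < p.2.1 <;> by_cases h2 : p.2.1 < p.2.2.1 <;>
      simp [prependPair, indicator, R_XYXYXY, R_XYXY, f6, f4, h1, h2, h3, h4, h5, mul_assoc]
  · have h' : p ∉ R_XYXYXY := fun hp => h hp.2.2
    simp [prependPair, indicator, h, h']

lemma measurableSet_R_XYXY : MeasurableSet R_XYXY := by
  simp only [R_XYXY, ofPred_and]
  refine (measurableSet_lt ?_ ?_).inter ((measurableSet_lt ?_ ?_).inter (measurableSet_lt ?_ ?_))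
    <;> fun_prop

lemma measurableSet_R_XYXYXY : MeasurableSet R_XYXYXY := by
  simp only [R_XYXYXY, ofPred_and]
  refine (measurableSet_lt ?_ ?_).inter ((measurableSet_lt ?_ ?_).inter
    ((measurableSet_lt ?_ ?_).inter ((measurableSet_lt ?_ ?_).inter (measurableSet_lt ?_ ?_))))
    <;> fun_prop

lemma setIntegral_f2 (hm : 0 < (2 * lam ^ 2).im) (hc : Continuous q) (hi : Integrable q) :
    (∫ p in R_XY, f2 q lam p)
      = ∫ x, (starRingEnd ℂ) (q x) * causalResolvent (2 * lam ^ 2) q x := by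
  rw [← integral_indicator measurableSet_R_XY]
  simpa using setIntegral_prod_univ_f2 hm hc hi univ

lemma setIntegral_f4 (hm : 0 < (2 * lam ^ 2).im) (hc : Continuous q) (hi : Integrable q) :
    (∫ p in R_XYXY, f4 q lam p)
      = ∫ x, (starRingEnd ℂ) (q x) * causalResolvent (2 * lam ^ 2)
          (fun y => q y * iteratedTail (2 * lam ^ 2) q (fun _ => 1) y) x := by
  rw [← integral_indicator measurableSet_R_XYXY, indicator_f4_eq_prependPair]
  have h := setIntegral_prod_univ_prependPair hm hc hi (integrable_indicator_f2 hm hc hi) univ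
  simp only [univ_prod_univ, Measure.restrict_univ, setIntegral_prod_univ_f2 hm hc hi] at h
  exact h

lemma setIntegral_f6 (hm : 0 < (2 * lam ^ 2).im) (hc : Continuous q) (hi : Integrable q) :
    (∫ p in R_XYXYXY, f6 q lam p)
      = ∫ x, (starRingEnd ℂ) (q x) * causalResolvent (2 * lam ^ 2)
          (fun y => q y * iteratedTail (2 * lam ^ 2) q
            (iteratedTail (2 * lam ^ 2) q (fun _ => 1)) y) x := by
  have h2 := integrable_indicator_f2 hm hc hi
  have h4 := integrable_prependPair hm hc hi h2
  rw [← integral_indicator measurableSet_R_XYXYXY, indicator_f6_eq_prependPair,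
    indicator_f4_eq_prependPair]
  have h := setIntegral_prod_univ_prependPair hm hc hi h4 univ
  simp only [univ_prod_univ, Measure.restrict_univ, setIntegral_prod_univ_prependPair hm hc hi h2,
    setIntegral_prod_univ_f2 hm hc hi] at h
  exact h

end Regions

section Fourier

lemma norm_inv_add_ofReal_le {m : ℂ} (hm : 0 < m.im) (s : ℝ) :
    ‖(m + (s : ℂ))⁻¹‖ ≤ m.im⁻¹ := by
  rw [norm_inv]
  gcongr
  have h := Complex.abs_im_le_norm (m + (s : ℂ))
  simp only [Complex.add_im, Complex.ofReal_im, add_zero] at h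
  exact (le_abs_self _).trans h

lemma add_ofReal_ne_zero {m : ℂ} (hm : 0 < m.im) (s : ℝ) : m + (s : ℂ) ≠ 0 := by
  intro h
  have := congrArg Complex.im h
  simp at this
  exact hm.ne' this

variable {X : Type*} [MeasureSpace X]

lemma integrable_div_add {m : ℂ} (hm : 0 < m.im) {F : X → ℂ} (hF : Integrable F) {φ : X → ℝ}
    (hφ : Measurable φ) : Integrable (fun p => F p / (m + φ p)) := by
  simp only [div_eq_mul_inv]
  exact hF.mul_bdd (by fun_prop) (Eventually.of_forall fun p => norm_inv_add_ofReal_le hm (φ p))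

variable [SFinite (volume : Measure X)]

/-- Division by `m + φ` on the frequency side is the causal resolvent on the physical side. -/
lemma integral_mul_exp_div_eq_causalResolvent {m : ℂ} (hm : 0 < m.im) {F : X → ℂ}
    (hF : Integrable F) {φ : X → ℝ} (hφ : Measurable φ) (x : ℝ) :
    (∫ p, F p * (Complex.exp (Complex.I * φ p * x) / (m + φ p)))
      = -Complex.I *
        causalResolvent m (fun t => ∫ p, F p * Complex.exp (Complex.I * φ p * t)) x := by
  have hre : ∀ s : ℝ, (Complex.I * (m + s)).re < 0 := by
    intro s
    simpa using hm
  have hexp : IntegrableOn (fun t : ℝ => Complex.exp (Complex.I * m * ((t - x : ℝ) : ℂ)))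
      (Ioi x) := by
    have h := (integrableOn_exp_mul_complex_Ioi (a := Complex.I * m) (by simpa using hre 0) x :
      IntegrableOn (fun t : ℝ => Complex.exp (Complex.I * m * t)) (Ioi x)).const_mul
        (Complex.exp (-(Complex.I * m * x)))
    refine h.congr (Eventually.of_forall fun t => ?_)
    simp only
    rw [← Complex.exp_add]
    congr 1
    push_cast
    ring
  have hnorm : ∀ s t : ℝ, ‖Complex.exp (Complex.I * s * t)‖ = 1 := by
    intro s t
    rw [show Complex.I * s * t = ((s * t : ℝ) : ℂ) * Complex.I by push_cast; ring]
    exact Complex.norm_exp_ofReal_mul_I _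
  have hint : Integrable (Function.uncurry fun (t : ℝ) (p : X) =>
      Complex.exp (Complex.I * m * ((t - x : ℝ) : ℂ)) *
        (F p * Complex.exp (Complex.I * φ p * t)))
      ((volume.restrict (Ioi x)).prod volume) := by
    have h := hexp.mul_prod hF
    have h' := h.mul_bdd (c := 1) (g := fun z : ℝ × X => Complex.exp (Complex.I * φ z.2 * z.1))
      (by fun_prop) (Eventually.of_forall fun z => (hnorm _ _).le)
    refine h'.congr (Eventually.of_forall fun z => ?_)
    simp only [Function.uncurry]
    ring
  rw [causalResolvent]
  simp only [← integral_const_mul (Complex.exp _)]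
  rw [integral_integral_swap hint, ← integral_const_mul]
  congr 1 with p
  have h1 : ∀ t : ℝ, Complex.exp (Complex.I * m * ((t - x : ℝ) : ℂ)) *
      (F p * Complex.exp (Complex.I * φ p * t))
      = F p * Complex.exp (-(Complex.I * m * x)) * Complex.exp (Complex.I * (m + φ p) * t) := by
    intro t
    rw [mul_assoc (F p), ← Complex.exp_add, mul_left_comm, ← Complex.exp_add]
    congr 2
    push_cast
    ring
  simp only [h1]
  rw [integral_const_mul, integral_exp_mul_complex_Ioi (hre _)]
  have h2 : Complex.exp (Complex.I * φ p * x) = Complex.exp (-(Complex.I * m * x)) *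
      Complex.exp (Complex.I * (m + φ p) * x) := by
    rw [← Complex.exp_add]
    congr 1
    ring
  have h3 := add_ofReal_ne_zero hm (φ p)
  rw [h2]
  field_simp [Complex.I_ne_zero]

lemma integral_mul_ft {q : ℝ → ℂ} (hi : Integrable q) {F : X → ℂ} (hF : Integrable F)
    {ψ : X → ℝ} (hψ : Measurable ψ) :
    (∫ p, F p * ft q (ψ p)) = ((Real.sqrt (2 * Real.pi) : ℝ) : ℂ)⁻¹ *
      ∫ x, q x * ∫ p, F p * Complex.exp (-Complex.I * x * ψ p) := by
  have hint : Integrable (Function.uncurry fun (x : ℝ) (p : X) =>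
      q x * (F p * Complex.exp (-Complex.I * x * ψ p))) (volume.prod volume) := by
    have h := (hi.mul_prod hF).mul_bdd (c := 1)
      (g := fun z : ℝ × X => Complex.exp (-Complex.I * z.1 * ψ z.2)) (by fun_prop)
      (Eventually.of_forall fun z => by
        rw [show -Complex.I * z.1 * ψ z.2 = ((-(z.1 * ψ z.2) : ℝ) : ℂ) * Complex.I by
          push_cast; ring]
        exact (Complex.norm_exp_ofReal_mul_I _).le)
    refine h.congr (Eventually.of_forall fun z => ?_)
    simp only [Function.uncurry]
    ring
  simp only [← integral_const_mul (q _)]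
  rw [integral_integral_swap hint, ← integral_const_mul]
  congr 1 with p
  rw [ft, mul_left_comm, ← integral_const_mul (F p)]
  congr 2 with x
  ring

lemma ft_eq_fourier (q : ℝ → ℂ) (ξ : ℝ) :
    ft q ξ = ((Real.sqrt (2 * Real.pi) : ℝ) : ℂ)⁻¹ *
      FourierTransform.fourier q ((2 * Real.pi)⁻¹ * ξ) := by
  rw [ft, Real.fourier_real_eq_integral_exp_smul]
  congr 2 with x
  rw [smul_eq_mul, mul_comm]
  congr 2
  have := Real.pi_ne_zero
  push_cast
  field_simp

lemma integrable_ft (q : SchwartzMap ℝ ℂ) : Integrable (ft q) := by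
  simp only [funext (ft_eq_fourier q), ← SchwartzMap.fourier_coe]
  exact ((SchwartzMap.integrable _).comp_mul_left' (by positivity)).const_mul _

lemma ofReal_sqrt_two_pi_sq : ((Real.sqrt (2 * Real.pi) : ℝ) : ℂ) ^ 2 = 2 * Real.pi := by
  rw [← Complex.ofReal_pow, Real.sq_sqrt (by positivity)]
  push_cast
  rfl

lemma integral_ft_mul_exp (q : SchwartzMap ℝ ℂ) (t : ℝ) :
    (∫ ξ, ft q ξ * Complex.exp (Complex.I * ξ * t))
      = ((Real.sqrt (2 * Real.pi) : ℝ) : ℂ) * q t := by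
  have hinv : FourierTransformInv.fourierInv (FourierTransform.fourier (q : ℝ → ℂ)) t = q t := by
    rw [q.continuous.fourierInv_fourier_eq q.integrable
      (by rw [← SchwartzMap.fourier_coe]; exact SchwartzMap.integrable _)]
  have hpi := Real.pi_ne_zero
  rw [Real.fourierInv_eq'] at hinv
  obtain ⟨G, hG⟩ : ∃ G : ℝ → ℂ, ∀ u,
      G u = Complex.exp (((2 * Real.pi * inner ℝ u t : ℝ) : ℂ) * Complex.I) •
        FourierTransform.fourier (q : ℝ → ℂ) u := ⟨_, fun _ => rfl⟩
  simp only [← hG] at hinv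
  have h : ∀ ξ : ℝ, ft q ξ * Complex.exp (Complex.I * ξ * t)
      = ((Real.sqrt (2 * Real.pi) : ℝ) : ℂ)⁻¹ * G ((2 * Real.pi)⁻¹ * ξ) := by
    intro ξ
    rw [ft_eq_fourier, hG, smul_eq_mul, mul_assoc]
    congr 1
    rw [mul_comm]
    congr 2
    simp only [RCLike.inner_apply, conj_trivial]
    push_cast
    field_simp
  have hc : ((Real.sqrt (2 * Real.pi) : ℝ) : ℂ) ≠ 0 := by
    rw [Complex.ofReal_ne_zero]; positivity
  simp only [h]
  rw [integral_const_mul, Measure.integral_comp_mul_left, hinv, inv_inv,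
    abs_of_pos (by positivity), Complex.real_smul]
  push_cast
  rw [← ofReal_sqrt_two_pi_sq]
  field_simp

lemma integral_conj_ft_mul_exp (q : SchwartzMap ℝ ℂ) (t : ℝ) :
    (∫ ξ, (starRingEnd ℂ) (ft q ξ) * Complex.exp (Complex.I * ξ * t))
      = ((Real.sqrt (2 * Real.pi) : ℝ) : ℂ) * (starRingEnd ℂ) (q (-t)) := by
  have h := congrArg (starRingEnd ℂ) (integral_ft_mul_exp q (-t))
  rw [← integral_conj, map_mul, Complex.conj_ofReal] at h
  rw [← h]
  congr 1 with ξ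
  rw [map_mul, ← Complex.exp_conj]
  simp

lemma causalResolvent_const_mul (m c : ℂ) (f : ℝ → ℂ) (x : ℝ) :
    causalResolvent m (fun t => c * f t) x = c * causalResolvent m f x := by
  rw [causalResolvent, causalResolvent, ← integral_const_mul]
  congr 1 with t
  ring

lemma integral_ft_div_mul_exp {m : ℂ} (hm : 0 < m.im) (q : SchwartzMap ℝ ℂ) (x : ℝ) :
    (∫ ξ, ft q ξ / (m + ξ) * Complex.exp (Complex.I * ξ * x))
      = -Complex.I * ((Real.sqrt (2 * Real.pi) : ℝ) : ℂ) * causalResolvent m q x := by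
  have h := integral_mul_exp_div_eq_causalResolvent hm (integrable_ft q) measurable_id x
  simp only [id, integral_ft_mul_exp, causalResolvent_const_mul] at h
  rw [mul_assoc, ← h]
  congr 1 with ξ
  ring

lemma integral_conj_ft_div_mul_exp {m : ℂ} (hm : 0 < m.im) (q : SchwartzMap ℝ ℂ) (x : ℝ) :
    (∫ ξ, (starRingEnd ℂ) (ft q ξ) / (m + ξ) * Complex.exp (-Complex.I * x * ξ))
      = -Complex.I * ((Real.sqrt (2 * Real.pi) : ℝ) : ℂ) * anticausalConj m q x := by
  have h := integral_mul_exp_div_eq_causalResolvent hm (integrable_conj (integrable_ft q))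
    measurable_id (-x)
  simp only [id, integral_conj_ft_mul_exp] at h
  rw [causalResolvent_const_mul] at h
  rw [anticausalConj, mul_assoc, ← h]
  congr 1 with ξ
  rw [show Complex.I * ξ * ((-x : ℝ) : ℂ) = -Complex.I * x * ξ by push_cast; ring]
  ring

lemma integral_prod_mul₅ (f₁ f₂ f₃ f₄ f₅ : ℝ → ℂ) :
    (∫ v : ℝ × ℝ × ℝ × ℝ × ℝ, f₁ v.1 * (f₂ v.2.1 * (f₃ v.2.2.1 * (f₄ v.2.2.2.1 * f₅ v.2.2.2.2))))
      = (∫ x, f₁ x) * ((∫ x, f₂ x) * ((∫ x, f₃ x) * ((∫ x, f₄ x) * ∫ x, f₅ x))) := by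
  rw [← integral_prod_mul f₄ f₅, ← integral_prod_mul f₃, ← integral_prod_mul f₂,
    ← integral_prod_mul f₁]
  rfl

/-- The frequency-side amplitude of the five free variables `(ξ₁, ξ₂, η₁, η₂, η₃)`. -/
noncomputable def amplitude (q : ℝ → ℂ) (m : ℂ) (v : ℝ × ℝ × ℝ × ℝ × ℝ) : ℂ :=
  ft q v.1 / (m + v.1) * (ft q v.2.1 / (m + v.2.1) * ((starRingEnd ℂ) (ft q v.2.2.1) *
    ((starRingEnd ℂ) (ft q v.2.2.2.1) / (m + v.2.2.2.1) *
      ((starRingEnd ℂ) (ft q v.2.2.2.2) / (m + v.2.2.2.2)))))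

lemma integrable_amplitude {m : ℂ} (hm : 0 < m.im) (q : SchwartzMap ℝ ℂ) :
    Integrable (amplitude q m) := by
  have h := integrable_ft q
  have h' := integrable_conj h
  have h1 := integrable_div_add hm h measurable_id
  have h2 := integrable_div_add hm h' measurable_id
  exact h1.mul_prod (h1.mul_prod (h'.mul_prod (h2.mul_prod h2)))

lemma integral_amplitude_div_mul_exp {m : ℂ} (hm : 0 < m.im) (q : SchwartzMap ℝ ℂ) (x : ℝ) :
    (∫ v, amplitude q m v / (m + v.2.2.1) * Complex.exp (-Complex.I * x *
        ((v.2.2.1 + v.2.2.2.1 + v.2.2.2.2 - v.1 - v.2.1 : ℝ) : ℂ)))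
      = -Complex.I * ((Real.sqrt (2 * Real.pi) : ℝ) : ℂ) ^ 5 *
        (causalResolvent m q x ^ 2 * anticausalConj m q x ^ 3) := by
  have h := integral_prod_mul₅
    (fun ξ => ft q ξ / (m + ξ) * Complex.exp (Complex.I * ξ * x))
    (fun ξ => ft q ξ / (m + ξ) * Complex.exp (Complex.I * ξ * x))
    (fun ξ => (starRingEnd ℂ) (ft q ξ) / (m + ξ) * Complex.exp (-Complex.I * x * ξ))
    (fun ξ => (starRingEnd ℂ) (ft q ξ) / (m + ξ) * Complex.exp (-Complex.I * x * ξ))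
    (fun ξ => (starRingEnd ℂ) (ft q ξ) / (m + ξ) * Complex.exp (-Complex.I * x * ξ))
  rw [integral_ft_div_mul_exp hm, integral_conj_ft_div_mul_exp hm] at h
  trans
  · refine Eq.trans ?_ h
    congr 1 with v
    rw [show -Complex.I * x * ((v.2.2.1 + v.2.2.2.1 + v.2.2.2.2 - v.1 - v.2.1 : ℝ) : ℂ)
      = Complex.I * v.1 * x + (Complex.I * v.2.1 * x + (-Complex.I * x * v.2.2.1 +
        (-Complex.I * x * v.2.2.2.1 + -Complex.I * x * v.2.2.2.2))) by push_cast; ring,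
      Complex.exp_add, Complex.exp_add, Complex.exp_add, Complex.exp_add, amplitude]
    ring
  · linear_combination (-Complex.I * ((Real.sqrt (2 * Real.pi) : ℝ) : ℂ) ^ 5 *
      (causalResolvent m q x ^ 2 * anticausalConj m q x ^ 3)) *
        (Complex.I ^ 2 - 1) * Complex.I_sq

lemma integral_amplitude_div_sub_mul_exp {m : ℂ} (hm : 0 < m.im) (q : SchwartzMap ℝ ℂ) (x : ℝ) :
    (∫ v, amplitude q m v / (m + ((v.1 + v.2.1 - v.2.2.1 : ℝ) : ℂ)) *
        Complex.exp (-Complex.I * x *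
          ((v.2.2.1 + v.2.2.2.1 + v.2.2.2.2 - v.1 - v.2.1 : ℝ) : ℂ)))
      = -Complex.I * ((Real.sqrt (2 * Real.pi) : ℝ) : ℂ) ^ 5 *
        (anticausalConj m q x ^ 2 * causalResolvent m
          (fun t => causalResolvent m q t ^ 2 * (starRingEnd ℂ) (q t)) x) := by
  have hF : Integrable (fun v : ℝ × ℝ × ℝ × ℝ × ℝ => amplitude q m v *
      Complex.exp (-Complex.I * x * ((v.2.2.2.1 + v.2.2.2.2 : ℝ) : ℂ))) :=
    (integrable_amplitude hm q).mul_bdd (c := 1) (by fun_prop)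
      (Eventually.of_forall fun v => by
        rw [show -Complex.I * x * ((v.2.2.2.1 + v.2.2.2.2 : ℝ) : ℂ)
          = ((-(x * (v.2.2.2.1 + v.2.2.2.2)) : ℝ) : ℂ) * Complex.I by push_cast; ring]
        exact (Complex.norm_exp_ofReal_mul_I _).le)
  have h := integral_mul_exp_div_eq_causalResolvent hm hF
    (φ := fun v : ℝ × ℝ × ℝ × ℝ × ℝ => v.1 + v.2.1 - v.2.2.1) (by fun_prop) x
  have hprod : ∀ t : ℝ, (∫ v : ℝ × ℝ × ℝ × ℝ × ℝ, amplitude q m v *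
      Complex.exp (-Complex.I * x * ((v.2.2.2.1 + v.2.2.2.2 : ℝ) : ℂ)) *
      Complex.exp (Complex.I * ((v.1 + v.2.1 - v.2.2.1 : ℝ) : ℂ) * t))
      = ((Real.sqrt (2 * Real.pi) : ℝ) : ℂ) ^ 5 * anticausalConj m q x ^ 2 *
        (causalResolvent m q t ^ 2 * (starRingEnd ℂ) (q t)) := by
    intro t
    have h := integral_prod_mul₅
      (fun ξ => ft q ξ / (m + ξ) * Complex.exp (Complex.I * ξ * t))
      (fun ξ => ft q ξ / (m + ξ) * Complex.exp (Complex.I * ξ * t))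
      (fun ξ => (starRingEnd ℂ) (ft q ξ) * Complex.exp (Complex.I * ξ * ((-t : ℝ) : ℂ)))
      (fun ξ => (starRingEnd ℂ) (ft q ξ) / (m + ξ) * Complex.exp (-Complex.I * x * ξ))
      (fun ξ => (starRingEnd ℂ) (ft q ξ) / (m + ξ) * Complex.exp (-Complex.I * x * ξ))
    rw [integral_ft_div_mul_exp hm, integral_conj_ft_div_mul_exp hm, integral_conj_ft_mul_exp,
      neg_neg] at h
    trans
    · refine Eq.trans ?_ h
      congr 1 with v
      rw [mul_assoc, ← Complex.exp_add,
        show -Complex.I * x * ((v.2.2.2.1 + v.2.2.2.2 : ℝ) : ℂ) +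
          Complex.I * ((v.1 + v.2.1 - v.2.2.1 : ℝ) : ℂ) * t
        = Complex.I * v.1 * t + (Complex.I * v.2.1 * t +
          (Complex.I * v.2.2.1 * ((-t : ℝ) : ℂ) +
          (-Complex.I * x * v.2.2.2.1 + -Complex.I * x * v.2.2.2.2))) by push_cast; ring,
        Complex.exp_add, Complex.exp_add, Complex.exp_add, Complex.exp_add, amplitude]
      ring
    · linear_combination (((Real.sqrt (2 * Real.pi) : ℝ) : ℂ) ^ 5 * anticausalConj m q x ^ 2 *
        (causalResolvent m q t ^ 2 * (starRingEnd ℂ) (q t))) *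
          (Complex.I ^ 2 - 1) * Complex.I_sq
  simp only [hprod] at h
  rw [causalResolvent_const_mul] at h
  trans
  · refine Eq.trans ?_ h
    congr 1 with v
    rw [show -Complex.I * x * ((v.2.2.1 + v.2.2.2.1 + v.2.2.2.2 - v.1 - v.2.1 : ℝ) : ℂ)
      = -Complex.I * x * ((v.2.2.2.1 + v.2.2.2.2 : ℝ) : ℂ) +
        Complex.I * ((v.1 + v.2.1 - v.2.2.1 : ℝ) : ℂ) * x by push_cast; ring, Complex.exp_add]
    ring
  · ring

lemma integral_amplitude_mul_ft {m : ℂ} (hm : 0 < m.im) (q : SchwartzMap ℝ ℂ) :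
    (∫ v, (amplitude q m v / (m + v.2.2.1) +
        amplitude q m v / (m + ((v.1 + v.2.1 - v.2.2.1 : ℝ) : ℂ))) *
        ft q (v.2.2.1 + v.2.2.2.1 + v.2.2.2.2 - v.1 - v.2.1))
      = -Complex.I * (4 * (Real.pi : ℂ) ^ 2) *
        ∫ x, q x * (causalResolvent m q x ^ 2 * anticausalConj m q x ^ 3 +
          anticausalConj m q x ^ 2 * causalResolvent m
            (fun t => causalResolvent m q t ^ 2 * (starRingEnd ℂ) (q t)) x) := by
  have i₁ : Integrable (fun v : ℝ × ℝ × ℝ × ℝ × ℝ => amplitude q m v / (m + v.2.2.1)) :=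
    integrable_div_add hm (integrable_amplitude hm q) (by fun_prop)
  have i₂ : Integrable (fun v : ℝ × ℝ × ℝ × ℝ × ℝ =>
      amplitude q m v / (m + ((v.1 + v.2.1 - v.2.2.1 : ℝ) : ℂ))) :=
    integrable_div_add hm (integrable_amplitude hm q) (by fun_prop)
  have hbd : ∀ x : ℝ, ∀ᵐ v : ℝ × ℝ × ℝ × ℝ × ℝ, ‖Complex.exp (-Complex.I * x *
      ((v.2.2.1 + v.2.2.2.1 + v.2.2.2.2 - v.1 - v.2.1 : ℝ) : ℂ))‖ ≤ 1 := fun x =>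
    Eventually.of_forall fun v => by
      rw [show ∀ s : ℝ, -Complex.I * x * (s : ℂ) = ((-(x * s) : ℝ) : ℂ) * Complex.I by
        intro s; push_cast; ring]
      exact (Complex.norm_exp_ofReal_mul_I _).le
  have hi : Integrable (q : ℝ → ℂ) := q.integrable
  have i₁₂ : Integrable (fun v : ℝ × ℝ × ℝ × ℝ × ℝ => amplitude q m v / (m + v.2.2.1) +
      amplitude q m v / (m + ((v.1 + v.2.1 - v.2.2.1 : ℝ) : ℂ))) := i₁.add i₂
  rw [integral_mul_ft hi i₁₂ (by fun_prop)]
  have hx : ∀ x : ℝ, (∫ v : ℝ × ℝ × ℝ × ℝ × ℝ, (amplitude q m v / (m + v.2.2.1) +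
        amplitude q m v / (m + ((v.1 + v.2.1 - v.2.2.1 : ℝ) : ℂ))) *
        Complex.exp (-Complex.I * x *
          ((v.2.2.1 + v.2.2.2.1 + v.2.2.2.2 - v.1 - v.2.1 : ℝ) : ℂ)))
      = -Complex.I * ((Real.sqrt (2 * Real.pi) : ℝ) : ℂ) ^ 5 *
        (causalResolvent m q x ^ 2 * anticausalConj m q x ^ 3 +
          anticausalConj m q x ^ 2 * causalResolvent m
            (fun t => causalResolvent m q t ^ 2 * (starRingEnd ℂ) (q t)) x) := by
    intro x
    simp only [add_mul]
    rw [integral_add (i₁.mul_bdd (by fun_prop) (hbd x)) (i₂.mul_bdd (by fun_prop) (hbd x)),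
      integral_amplitude_div_mul_exp hm, integral_amplitude_div_sub_mul_exp hm]
    ring
  simp only [hx, mul_left_comm (q _)]
  rw [integral_const_mul, ← mul_assoc]
  congr 1
  have hc : ((Real.sqrt (2 * Real.pi) : ℝ) : ℂ) ≠ 0 := by
    rw [Complex.ofReal_ne_zero]; positivity
  rw [show (4 * (Real.pi : ℂ) ^ 2) = (2 * Real.pi) ^ 2 by ring, ← ofReal_sqrt_two_pi_sq]
  field_simp

end Fourier

/-- For Schwartz `q` and `Im(λ²) > 0`, with `s₂(λ) = −λ²·I_λ({x₁<y₁})`,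
`s₄(λ) = λ⁴·I_λ({x₁<y₁<x₂<y₂})`, `s₆(λ) = −λ⁶·I_λ({x₁<y₁<x₂<y₂<x₃<y₃})` and
`b₆(λ) = s₆ − s₂s₄ + s₂³/3`, one has the Fourier representation
(with variables `v = (ξ₁, ξ₂, η₁, η₂, η₃)` and `ξ₃ := η₁+η₂+η₃−ξ₁−ξ₂`)
`b₆(λ) = −(i/(4π²)) ∫_{ℝ⁵} λ⁶/((2λ²+ξ₁)(2λ²+ξ₂)(2λ²+η₂)(2λ²+η₃))
           · (1/(2λ²+η₁) + 1/(2λ²+ξ₁+ξ₂−η₁))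
           · q̂(ξ₁)q̂(ξ₂)q̂(ξ₃)conj(q̂(η₁))conj(q̂(η₂))conj(q̂(η₃)) dξ₁dξ₂dη₁dη₂dη₃`. -/
theorem b6_fourier (q : SchwartzMap ℝ ℂ) (lam : ℂ) (hlam : 0 < (lam ^ 2).im) :
    (-lam ^ 6 * ∫ p in R_XYXYXY, f6 ⇑q lam p)
      - (-lam ^ 2 * ∫ p in R_XY, f2 ⇑q lam p) * (lam ^ 4 * ∫ p in R_XYXY, f4 ⇑q lam p)
      + (-lam ^ 2 * ∫ p in R_XY, f2 ⇑q lam p) ^ 3 / 3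
      = -(Complex.I / (4 * (Real.pi : ℂ) ^ 2)) *
          ∫ v : ℝ × ℝ × ℝ × ℝ × ℝ,
            lam ^ 6 /
                ((2 * lam ^ 2 + (v.1 : ℂ)) * (2 * lam ^ 2 + (v.2.1 : ℂ))
                  * (2 * lam ^ 2 + (v.2.2.2.1 : ℂ)) * (2 * lam ^ 2 + (v.2.2.2.2 : ℂ)))
              * (1 / (2 * lam ^ 2 + (v.2.2.1 : ℂ))
                  + 1 / (2 * lam ^ 2 + (v.1 : ℂ) + (v.2.1 : ℂ) - (v.2.2.1 : ℂ)))
              * (ft ⇑q v.1 * ft ⇑q v.2.1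
                  * ft ⇑q (v.2.2.1 + v.2.2.2.1 + v.2.2.2.2 - v.1 - v.2.1)
                  * (starRingEnd ℂ) (ft ⇑q v.2.2.1)
                  * (starRingEnd ℂ) (ft ⇑q v.2.2.2.1)
                  * (starRingEnd ℂ) (ft ⇑q v.2.2.2.2)) := by
  have hm : 0 < (2 * lam ^ 2).im := by simpa using hlam
  have hc := q.continuous
  have hi : Integrable (q : ℝ → ℂ) := q.integrable
  have hcum := cumulant_eq_integral_resolvents hm hc hi rfl rfl rfl rfl rfl rfl
  rw [← setIntegral_f2 hm hc hi, ← setIntegral_f4 hm hc hi, ← setIntegral_f6 hm hc hi] at hcum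
  have hft := integral_amplitude_mul_ft hm q
  have hv : ∀ v : ℝ × ℝ × ℝ × ℝ × ℝ,
      lam ^ 6 /
          ((2 * lam ^ 2 + (v.1 : ℂ)) * (2 * lam ^ 2 + (v.2.1 : ℂ))
            * (2 * lam ^ 2 + (v.2.2.2.1 : ℂ)) * (2 * lam ^ 2 + (v.2.2.2.2 : ℂ)))
        * (1 / (2 * lam ^ 2 + (v.2.2.1 : ℂ))
            + 1 / (2 * lam ^ 2 + (v.1 : ℂ) + (v.2.1 : ℂ) - (v.2.2.1 : ℂ)))
        * (ft ⇑q v.1 * ft ⇑q v.2.1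
            * ft ⇑q (v.2.2.1 + v.2.2.2.1 + v.2.2.2.2 - v.1 - v.2.1)
            * (starRingEnd ℂ) (ft ⇑q v.2.2.1)
            * (starRingEnd ℂ) (ft ⇑q v.2.2.2.1)
            * (starRingEnd ℂ) (ft ⇑q v.2.2.2.2))
      = lam ^ 6 * ((amplitude q (2 * lam ^ 2) v / (2 * lam ^ 2 + v.2.2.1) +
        amplitude q (2 * lam ^ 2) v / (2 * lam ^ 2 + ((v.1 + v.2.1 - v.2.2.1 : ℝ) : ℂ))) *
        ft q (v.2.2.1 + v.2.2.2.1 + v.2.2.2.2 - v.1 - v.2.1)) := by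
    intro v
    rw [amplitude, show 2 * lam ^ 2 + (v.1 : ℂ) + (v.2.1 : ℂ) - (v.2.2.1 : ℂ)
      = 2 * lam ^ 2 + ((v.1 + v.2.1 - v.2.2.1 : ℝ) : ℂ) by push_cast; ring]
    simp only [div_eq_mul_inv, mul_inv]
    ring
  simp only [hv]
  rw [integral_const_mul, hft, ← neg_eq_iff_eq_neg.2 hcum]
  have hpi : (Real.pi : ℂ) ≠ 0 := Complex.ofReal_ne_zero.2 Real.pi_ne_zero
  field_simp
  linear_combination (lam ^ 6 * (-3 * (∫ p in R_XYXYXY, f6 ⇑q lam p) +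
    3 * (∫ p in R_XY, f2 ⇑q lam p) * (∫ p in R_XYXY, f4 ⇑q lam p) -
    (∫ p in R_XY, f2 ⇑q lam p) ^ 3)) * Complex.I_sq
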